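/- arXiv:2202.12961 — 8 statements merged into one kernel-verified Lean document; each statement's English description precedes it below -/
import Mathlib

section
/- Fix n ≥ 1 and constants L_F > 0, L_q > 0, κ̄ ≥ 0, Λ > 0. Let F, q : ℝⁿ → ℝ be continuously differentiable with ‖∇F(x) − ∇F(x̄)‖₂ ≤ L_F‖x − x̄‖₂ and ‖∇q(x) − ∇q(x̄)‖₂ ≤ L_q‖x − x̄‖₂ for all x, x̄ ∈ ℝⁿ. Let x₀ ∈ ℝⁿ, Δ > 0, and d₁, …, dₙ ∈ ℝⁿ with ‖d_j‖₂ ≤ Δ for all j, such that the matrix D = [d₁ ⋯ dₙ] ∈ ℝ^{n×n} is invertible with ‖D^{−1}‖₂ ≤ Λ/Δ, and such that |q(x₀ + d) − F(x₀ + d)| ≤ κ̄Δ² for every d ∈ {0, d₁, …, dₙ}. Then, setting κ̂_eg := √n · Λ · ((5/2)(L_F + L_q) + 2κ̄) and κ̂_ef := κ̂_eg + (1/2)(L_F + L_q) + κ̄, one has for every s ∈ ℝⁿ with ‖s‖₂ ≤ Δ that ‖∇q(x₀ + s) − ∇F(x₀ + s)‖₂ ≤ κ̂_eg Δ and |q(x₀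 + s) − F(x₀ + s)| ≤ κ̂_ef Δ². -/
open scoped RealInnerProductSpace

/-- First-order Taylor bound for a function with `L`-Lipschitz gradient. -/
theorem abs_sub_sub_inner_gradient_le {E : Type*} [NormedAddCommGroup E] [InnerProductSpace ℝ E]
    [CompleteSpace E] {h : E → ℝ} {g : E → E} {L : ℝ} (hh : ∀ x, HasGradientAt h (g x) x)
    (hL : ∀ x y, ‖g x - g y‖ ≤ L * ‖x - y‖) (x d : E) :
    |h (x + d) - h x - ⟪g x, d⟫| ≤ L / 2 * ‖d‖ ^ 2 := by
  have hderiv : ∀ t : ℝ, HasDerivAt (fun t : ℝ => h (x + t • d) - h x - t * ⟪g x, d⟫)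
      (⟪g (x + t • d), d⟫ - ⟪g x, d⟫) t := by
    intro t
    have hline : HasDerivAt (fun t : ℝ => x + t • d) d t := by
      simpa using ((hasDerivAt_id t).smul_const d).const_add x
    have hcomp := (hh (x + t • d)).hasFDerivAt.comp_hasDerivAt t hline
    have hlin : HasDerivAt (fun t : ℝ => t * ⟪g x, d⟫) ⟪g x, d⟫ t := by
      simpa using (hasDerivAt_id t).mul_const ⟪g x, d⟫
    exact ((hcomp.sub_const (h x)).sub hlin).congr_deriv (by simp)
  have hB : ∀ t : ℝ, HasDerivAt (fun t : ℝ => L / 2 * ‖d‖ ^ 2 * t ^ 2) (L * ‖d‖ ^ 2 * t) t := by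
    intro t
    refine ((hasDerivAt_pow 2 t).const_mul (L / 2 * ‖d‖ ^ 2)).congr_deriv ?_
    norm_num
    ring
  have key := image_norm_le_of_norm_deriv_right_le_deriv_boundary (a := (0 : ℝ)) (b := 1)
    (fun t _ => (hderiv t).continuousAt.continuousWithinAt)
    (fun t _ => (hderiv t).hasDerivWithinAt) (by simp) hB
    (by
      intro t ht
      rw [← inner_sub_left]
      calc ‖⟪g (x + t • d) - g x, d⟫‖ ≤ ‖g (x + t • d) - g x‖ * ‖d‖ := norm_inner_le_norm _ _
        _ ≤ L * ‖x + t • d - x‖ * ‖d‖ := by gcongr; exact hL _ _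
        _ = L * ‖d‖ ^ 2 * t := by
          rw [add_sub_cancel_left, norm_smul, Real.norm_of_nonneg ht.1]
          ring)
    (Set.right_mem_Icc.2 zero_le_one)
  simpa using key

/-- If `Δ * ‖c‖ ≤ Λ * ‖∑ j, c j • d j‖` for all `c`, a vector whose inner products with the `d j`
are at most `M` has norm controlled by `√n * Λ * M / Δ`. -/
theorem mul_norm_le_of_abs_inner_le {n : ℕ} {d : Fin n → EuclideanSpace ℝ (Fin n)} {Δ Λ M : ℝ}
    (hΔ : 0 < Δ) (hΛ : 0 ≤ Λ) (hM : 0 ≤ M)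
    (hd : ∀ c : EuclideanSpace ℝ (Fin n), Δ * ‖c‖ ≤ Λ * ‖∑ j, c j • d j‖)
    {v : EuclideanSpace ℝ (Fin n)} (hv : ∀ j, |⟪d j, v⟫| ≤ M) :
    Δ * ‖v‖ ≤ √n * Λ * M := by
  let T : EuclideanSpace ℝ (Fin n) →ₗ[ℝ] EuclideanSpace ℝ (Fin n) :=
    { toFun := fun c => ∑ j, c j • d j
      map_add' := fun a b => by simp [add_smul, Finset.sum_add_distrib]
      map_smul' := fun r a => by simp [mul_smul, Finset.smul_sum] }
  have hinj : Function.Injective T := by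
    rw [injective_iff_map_eq_zero]
    intro c hc
    have h1 := hd c
    have h2 : ∑ j, c j • d j = 0 := hc
    rw [h2, norm_zero, mul_zero] at h1
    exact norm_le_zero_iff.1 (nonpos_of_mul_nonpos_right h1 hΔ)
  obtain ⟨c, hc⟩ := LinearMap.surjective_of_injective hinj v
  replace hc : ∑ j, c j • d j = v := hc
  let w : EuclideanSpace ℝ (Fin n) := WithLp.toLp 2 fun j => ⟪d j, v⟫
  have hw : ‖w‖ ≤ √n * M := by
    rw [EuclideanSpace.norm_eq]
    refine Real.sqrt_le_iff.2 ⟨by positivity, ?_⟩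
    rw [mul_pow, Real.sq_sqrt (Nat.cast_nonneg n)]
    calc ∑ j, ‖w j‖ ^ 2 ≤ ∑ _j : Fin n, M ^ 2 := by
          refine Finset.sum_le_sum fun j _ => ?_
          exact pow_le_pow_left₀ (norm_nonneg _) (hv j) 2
      _ = n * M ^ 2 := by simp
  have hsq : ‖v‖ ^ 2 ≤ ‖c‖ * ‖w‖ := by
    have h1 : ‖v‖ ^ 2 = ⟪c, w⟫ := by
      rw [← real_inner_self_eq_norm_sq]
      nth_rewrite 1 [← hc]
      rw [sum_inner, PiLp.inner_apply]
      refine Finset.sum_congr rfl fun j _ => ?_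
      rw [real_inner_smul_left]
      exact mul_comm _ _
    rw [h1]
    exact real_inner_le_norm c w
  have hcv : Δ * ‖c‖ ≤ Λ * ‖v‖ := by simpa [hc] using hd c
  rcases (norm_nonneg v).eq_or_lt with h0 | h0
  · rw [← h0, mul_zero]
    positivity
  refine le_of_mul_le_mul_right ?_ h0
  calc Δ * ‖v‖ * ‖v‖ = Δ * ‖v‖ ^ 2 := by ring
    _ ≤ Δ * (‖c‖ * ‖w‖) := by gcongr
    _ = Δ * ‖c‖ * ‖w‖ := by ring
    _ ≤ Λ * ‖v‖ * (√n * M) := by gcongr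
    _ = √n * Λ * M * ‖v‖ := by ring

/-- A model `q` interpolating approximate values of `F` (error at most
`κ̄Δ²`) on a well-poised interpolation set `{d₁,…,dₙ}` (with `‖D⁻¹‖₂ ≤ Λ/Δ`, encoded
equivalently as `Δ‖c‖ ≤ Λ‖∑ cⱼdⱼ‖` for all coefficient vectors `c`) is fully linear with
respect to `F` on the ball of radius `Δ`, with the stated constants. -/
theorem stmt_0 (n : ℕ) (hn : 1 ≤ n)
    (LF Lq κbar Λ : ℝ) (hLF : 0 < LF) (hLq : 0 < Lq) (hκbar : 0 ≤ κbar) (hΛ : 0 < Λ)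
    (F q : EuclideanSpace ℝ (Fin n) → ℝ)
    (gF gq : EuclideanSpace ℝ (Fin n) → EuclideanSpace ℝ (Fin n))
    (hFc : ContDiff ℝ 1 F) (hqc : ContDiff ℝ 1 q)
    (hF : ∀ x, HasGradientAt F (gF x) x)
    (hq : ∀ x, HasGradientAt q (gq x) x)
    (hFlip : ∀ x y, ‖gF x - gF y‖ ≤ LF * ‖x - y‖)
    (hqlip : ∀ x y, ‖gq x - gq y‖ ≤ Lq * ‖x - y‖)
    (x₀ : EuclideanSpace ℝ (Fin n)) (Δ : ℝ) (hΔ : 0 < Δ)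
    (d : Fin n → EuclideanSpace ℝ (Fin n))
    (hd : ∀ j, ‖d j‖ ≤ Δ)
    (hpoise : ∀ c : EuclideanSpace ℝ (Fin n), Δ * ‖c‖ ≤ Λ * ‖∑ j, c j • d j‖)
    (hinterp0 : |q x₀ - F x₀| ≤ κbar * Δ ^ 2)
    (hinterp : ∀ j, |q (x₀ + d j) - F (x₀ + d j)| ≤ κbar * Δ ^ 2) :
    ∀ s : EuclideanSpace ℝ (Fin n), ‖s‖ ≤ Δ →
      ‖gq (x₀ + s) - gF (x₀ + s)‖
          ≤ (Real.sqrt n * Λ * ((5 / 2) * (LF + Lq) + 2 * κbar)) * Δ ∧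
      |q (x₀ + s) - F (x₀ + s)|
          ≤ (Real.sqrt n * Λ * ((5 / 2) * (LF + Lq) + 2 * κbar)
              + (1 / 2) * (LF + Lq) + κbar) * Δ ^ 2 := by
  have hh : ∀ x, HasGradientAt (fun y => q y - F y) (gq x - gF x) x := fun x => by
    rw [hasGradientAt_iff_hasFDerivAt, map_sub]
    exact (hq x).hasFDerivAt.sub (hF x).hasFDerivAt
  have hlip : ∀ x y, ‖(gq x - gF x) - (gq y - gF y)‖ ≤ (LF + Lq) * ‖x - y‖ := fun x y => by
    calc ‖(gq x - gF x) - (gq y - gF y)‖ = ‖(gq x - gq y) - (gF x - gF y)‖ := by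
          congr 1; abel
      _ ≤ ‖gq x - gq y‖ + ‖gF x - gF y‖ := norm_sub_le _ _
      _ ≤ (LF + Lq) * ‖x - y‖ := by linarith [hFlip x y, hqlip x y]
  have htaylor := abs_sub_sub_inner_gradient_le hh hlip
  have hball : ∀ s : EuclideanSpace ℝ (Fin n), ‖s‖ ≤ Δ →
      (LF + Lq) / 2 * ‖s‖ ^ 2 ≤ (LF + Lq) / 2 * Δ ^ 2 := fun s hs => by gcongr
  have hone : 1 ≤ √n * Λ := by
    have hn1 : 1 ≤ √(n : ℝ) := Real.one_le_sqrt.2 (by exact_mod_cast hn)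
    have hΛ1 : 1 ≤ Λ := by
      have h1 := hpoise (EuclideanSpace.single ⟨0, hn⟩ 1)
      simp [ite_smul] at h1
      have h2 := mul_le_mul_of_nonneg_left (hd ⟨0, hn⟩) hΛ.le
      exact le_of_mul_le_mul_right (by linarith) hΔ
    exact one_le_mul_of_one_le_of_one_le hn1 hΛ1
  have hcenter : ‖gq x₀ - gF x₀‖ ≤ √n * Λ * (((LF + Lq) / 2 + 2 * κbar) * Δ) := by
    have h1 := mul_norm_le_of_abs_inner_le (v := gq x₀ - gF x₀)
      (M := ((LF + Lq) / 2 + 2 * κbar) * Δ ^ 2) hΔ hΛ.le (by positivity) hpoise (fun j => by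
        have h2 := abs_le.1 (htaylor x₀ (d j))
        have h3 := abs_le.1 hinterp0
        have h4 := abs_le.1 (hinterp j)
        have h5 := hball (d j) (hd j)
        rw [real_inner_comm, abs_le]
        constructor <;> linarith [h2.1, h2.2])
    refine le_of_mul_le_mul_left (h1.trans_eq ?_) hΔ
    ring
  intro s hs
  have hgrad : ‖gq (x₀ + s) - gF (x₀ + s)‖
      ≤ (√n * Λ * ((5 / 2) * (LF + Lq) + 2 * κbar)) * Δ := by
    have h1 := hlip (x₀ + s) x₀
    rw [add_sub_cancel_left] at h1
    have h2 := norm_le_norm_add_norm_sub' (gq (x₀ + s) - gF (x₀ + s)) (gq x₀ - gF x₀)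
    have h3 : (LF + Lq) * ‖s‖ ≤ (LF + Lq) * Δ := by gcongr
    have h4 : 0 ≤ (LF + Lq) * Δ := by positivity
    nlinarith [mul_le_mul_of_nonneg_right hone h4]
  refine ⟨hgrad, ?_⟩
  have h1 := htaylor (x₀ + s) (-s)
  rw [add_neg_cancel_right, inner_neg_right, norm_neg] at h1
  have h2 := abs_le.1 (h1.trans (hball s hs))
  have h3 := abs_le.1 hinterp0
  have h4 : |⟪gq (x₀ + s) - gF (x₀ + s), s⟫|
      ≤ (√n * Λ * ((5 / 2) * (LF + Lq) + 2 * κbar)) * Δ * Δ :=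
    (abs_real_inner_le_norm _ _).trans (by gcongr)
  have h5 := abs_le.1 h4
  rw [abs_le]
  constructor <;> linarith [h2.1, h2.2]
end

section
/- Let n, p ≥ 1 and let F : ℝⁿ → ℝ^p have continuously differentiable components F_i with, for each i ∈ {1,…,p} and all x, x̄ ∈ ℝⁿ: |F_i(x) − F_i(x̄)| ≤ L_{F_i}‖x − x̄‖₂ and ‖∇F_i(x) − ∇F_i(x̄)‖₂ ≤ L_{∇F_i}‖x − x̄‖₂. Let h : ℝ^p → ℝ be continuously differentiable with ‖∇h(y) − ∇h(ȳ)‖₂ ≤ L_{∇h}‖y − ȳ‖₂ and ‖∇h(y)‖₂ ≤ κ_{∇h} for all y, ȳ ∈ ℝ^p. Define f(x) := h(F(x)), L_F := Σ_{i=1}^{p} L_{F_i}, L̄_F := (Σ_{i=1}^{p} L_{F_i}²)^{1/2}, and L_{∇F} := Σ_{i=1}^{p} L_{∇F_i}. Then ‖∇f(x) − ∇f(x̄)‖₂ ≤ (L_F · L_{∇h} · L̄_F + κ_{∇h} · L_{∇F}) ‖x − x̄‖₂ for all x, x̄ ∈ ℝⁿ. -/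
open scoped RealInnerProductSpace

theorem nonneg_of_forall_nonneg_mul_norm_sub {E : Type*} [NormedAddCommGroup E] [Nontrivial E]
    {C : ℝ} (hC : ∀ x y : E, 0 ≤ C * ‖x - y‖) : 0 ≤ C := by
  obtain ⟨v, hv⟩ := exists_ne (0 : E)
  have hCv := hC v 0
  rw [sub_zero] at hCv
  exact nonneg_of_mul_nonneg_left hCv (norm_pos_iff.mpr hv)

theorem HasGradientAt.norm_le_of_lipschitz {E : Type*} [NormedAddCommGroup E]
    [InnerProductSpace ℝ E] [CompleteSpace E] {f : E → ℝ} {g x : E} {C : ℝ} (hC : 0 ≤ C)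
    (hf : HasGradientAt f g x) (hlip : ∀ y, |f y - f x| ≤ C * ‖y - x‖) : ‖g‖ ≤ C := by
  rw [← LinearIsometryEquiv.norm_map (InnerProductSpace.toDual ℝ E) g]
  exact hf.hasFDerivAt.le_of_lip' hC (Filter.Eventually.of_forall hlip)

theorem HasGradientAt.eq_sum_smul_of_comp {E ι : Type*} [NormedAddCommGroup E]
    [InnerProductSpace ℝ E] [CompleteSpace E] [Fintype ι]
    {F : E → EuclideanSpace ℝ ι} {h : EuclideanSpace ℝ ι → ℝ} {gF : ι → E}
    {gh : EuclideanSpace ℝ ι} {g x : E}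
    (hF : ∀ i, HasGradientAt (fun z => F z i) (gF i) x) (hh : HasGradientAt h gh (F x))
    (hg : HasGradientAt (fun z => h (F z)) g x) : g = ∑ i, gh i • gF i := by
  have hFd : DifferentiableAt ℝ F x :=
    differentiableAt_euclidean.mpr fun i => (hF i).differentiableAt
  have hcomp := hg.hasFDerivAt.unique (hh.hasFDerivAt.comp x hFd.hasFDerivAt)
  have hcoord (i : ι) (v : E) : fderiv ℝ F x v i = ⟪gF i, v⟫ :=
    (DFunLike.congr_fun ((hF i).hasFDerivAt.unique
      ((EuclideanSpace.proj i : EuclideanSpace ℝ ι →L[ℝ] ℝ).hasFDerivAt.comp x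
        hFd.hasFDerivAt)) v).symm
  refine ext_inner_right ℝ fun v => ?_
  have hv := DFunLike.congr_fun hcomp v
  simp only [InnerProductSpace.toDual_apply_apply, ContinuousLinearMap.comp_apply] at hv
  rw [hv, PiLp.inner_apply, sum_inner]
  refine Finset.sum_congr rfl fun i _ => ?_
  rw [hcoord, real_inner_smul_left]
  simp [mul_comm]

theorem EuclideanSpace.norm_le_sqrt_sum_sq_mul {ι : Type*} [Fintype ι]
    {v : EuclideanSpace ℝ ι} {L : ι → ℝ} {d : ℝ} (hd : 0 ≤ d) (hv : ∀ i, |v i| ≤ L i * d) :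
    ‖v‖ ≤ √(∑ i, L i ^ 2) * d := by
  rw [EuclideanSpace.norm_eq, ← Real.sqrt_sq hd, ← Real.sqrt_mul (by positivity), Finset.sum_mul]
  refine Real.sqrt_le_sqrt (Finset.sum_le_sum fun i _ => ?_)
  rw [← mul_pow]
  exact pow_le_pow_left₀ (norm_nonneg _) (hv i) 2

/-- Lipschitz bound on the gradient of the composite objective
`f = h ∘ F`: any gradients of `f` (encoded via `HasGradientAt`) satisfy
`‖∇f(x) − ∇f(x̄)‖₂ ≤ (L_F · L_{∇h} · L̄_F + κ_{∇h} · L_{∇F}) ‖x − x̄‖₂`. -/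
theorem stmt_3 (n p : ℕ) (hn : 1 ≤ n) (hp : 1 ≤ p)
    (F : EuclideanSpace ℝ (Fin n) → EuclideanSpace ℝ (Fin p))
    (gF : Fin p → EuclideanSpace ℝ (Fin n) → EuclideanSpace ℝ (Fin n))
    (h : EuclideanSpace ℝ (Fin p) → ℝ)
    (gh : EuclideanSpace ℝ (Fin p) → EuclideanSpace ℝ (Fin p))
    (LF LdF : Fin p → ℝ) (Ldh κgh : ℝ)
    (hFc : ContDiff ℝ 1 F) (hhc : ContDiff ℝ 1 h)
    (hgF : ∀ i x, HasGradientAt (fun x' => F x' i) (gF i x) x)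
    (hFlip : ∀ i x x', |F x i - F x' i| ≤ LF i * ‖x - x'‖)
    (hgFlip : ∀ i x x', ‖gF i x - gF i x'‖ ≤ LdF i * ‖x - x'‖)
    (hgh : ∀ y, HasGradientAt h (gh y) y)
    (hghlip : ∀ y y', ‖gh y - gh y'‖ ≤ Ldh * ‖y - y'‖)
    (hghbd : ∀ y, ‖gh y‖ ≤ κgh) :
    ∀ (x x' : EuclideanSpace ℝ (Fin n)) (g g' : EuclideanSpace ℝ (Fin n)),
      HasGradientAt (fun z => h (F z)) g x →
      HasGradientAt (fun z => h (F z)) g' x' →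
      ‖g - g'‖ ≤ ((∑ i, LF i) * Ldh * Real.sqrt (∑ i, (LF i) ^ 2)
          + κgh * (∑ i, LdF i)) * ‖x - x'‖ := by
  intro x x' g g' hg hg'
  have : Nonempty (Fin n) := ⟨⟨0, hn⟩⟩
  have : Nonempty (Fin p) := ⟨⟨0, hp⟩⟩
  have hLF (i : Fin p) : 0 ≤ LF i :=
    nonneg_of_forall_nonneg_mul_norm_sub fun y y' => (abs_nonneg _).trans (hFlip i y y')
  have hLdh : 0 ≤ Ldh :=
    nonneg_of_forall_nonneg_mul_norm_sub fun y y' => (norm_nonneg _).trans (hghlip y y')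
  have hgF_le (i : Fin p) : ‖gF i x‖ ≤ LF i :=
    (hgF i x).norm_le_of_lipschitz (hLF i) fun y => hFlip i y x
  have hF_sub : ‖F x - F x'‖ ≤ √(∑ i, LF i ^ 2) * ‖x - x'‖ :=
    EuclideanSpace.norm_le_sqrt_sum_sq_mul (norm_nonneg _) fun i => hFlip i x x'
  have hgh_sub : ‖gh (F x) - gh (F x')‖ ≤ Ldh * (√(∑ i, LF i ^ 2) * ‖x - x'‖) :=
    (hghlip _ _).trans (mul_le_mul_of_nonneg_left hF_sub hLdh)
  have hκ : 0 ≤ κgh := (norm_nonneg _).trans (hghbd (F x))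
  have hsplit : g - g' = ∑ i, ((gh (F x) - gh (F x')) i • gF i x
      + gh (F x') i • (gF i x - gF i x')) := by
    rw [HasGradientAt.eq_sum_smul_of_comp (fun i => hgF i x) (hgh _) hg,
      HasGradientAt.eq_sum_smul_of_comp (fun i => hgF i x') (hgh _) hg',
      ← Finset.sum_sub_distrib]
    refine Finset.sum_congr rfl fun i _ => ?_
    rw [PiLp.sub_apply]
    module
  calc ‖g - g'‖
      ≤ ∑ i, (Ldh * (√(∑ j, LF j ^ 2) * ‖x - x'‖) * LF i + κgh * (LdF i * ‖x - x'‖)) := by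
        rw [hsplit]
        refine norm_sum_le_of_le _ fun i _ => norm_add_le_of_le ?_ ?_
        · rw [norm_smul]
          exact mul_le_mul ((PiLp.norm_apply_le _ i).trans hgh_sub) (hgF_le i)
            (norm_nonneg _) (by positivity)
        · rw [norm_smul]
          exact mul_le_mul ((PiLp.norm_apply_le _ i).trans (hghbd _)) (hgFlip i x x')
            (norm_nonneg _) hκ
    _ = _ := by
        rw [Finset.sum_add_distrib, ← Finset.mul_sum, ← Finset.mul_sum, ← Finset.sum_mul]
        ring
end

section
/- Let Z ∈ ℝ^{n×m} have orthonormal columns, let z be one of the columns of Z, let τ̄₁, …, τ̄ₙ ∈ [0, ∞], let j* be any index maximizing |z_j| over j ∈ {1,…,n}, and assume τ̄_{j*} < ∞. Let T ∈ ℝ satisfy T ≥ τ̄_{j*}, and define d ∈ ℝⁿ by d_j = min(T, τ̄_j) z_j for each j (with min(T, ∞) = T). Then ‖Zᵀd‖₂² ≥ τ̄_{j*}² / n². -/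
open Matrix
open scoped ENNReal

/-- For `Z` with orthonormal columns, `z` a column of `Z`, breakpoints
`τ̄ ∈ [0,∞]ⁿ`, `j*` maximizing `|z_j|` with `τ̄_{j*} < ∞`, and `T ≥ τ̄_{j*}`, the clipped step
`d_j = min(T, τ̄_j) z_j` satisfies `‖Zᵀd‖₂² ≥ τ̄_{j*}²/n²`. -/
theorem stmt_6 (n m : ℕ) (Z : Matrix (Fin n) (Fin m) ℝ) (hZ : Zᵀ * Z = 1)
    (k : Fin m) (τbar : Fin n → ℝ≥0∞) (jstar : Fin n)
    (hjstar : ∀ j, |Z j k| ≤ |Z jstar k|)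
    (hfin : τbar jstar < ⊤)
    (T : ℝ) (hT : (τbar jstar).toReal ≤ T) :
    (τbar jstar).toReal ^ 2 / (n : ℝ) ^ 2
      ≤ ∑ i, (∑ j, Z j i * ((min (ENNReal.ofReal T) (τbar j)).toReal * Z j k)) ^ 2 := by
  have hone : ∑ j, Z j k ^ 2 = 1 := by
    have h := congrFun (congrFun hZ k) k
    rw [Matrix.mul_apply, Matrix.one_apply_eq] at h
    simpa [Matrix.transpose_apply, sq] using h
  have hn : (0 : ℝ) < n := by
    exact_mod_cast Fin.pos jstar
  have hmax : 1 / (n : ℝ) ≤ Z jstar k ^ 2 := by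
    rw [div_le_iff₀ hn, ← hone]
    calc ∑ j, Z j k ^ 2 ≤ ∑ _j : Fin n, Z jstar k ^ 2 :=
          Finset.sum_le_sum fun j _ => sq_le_sq.mpr (hjstar j)
      _ = Z jstar k ^ 2 * n := by simp [mul_comm]
  have hmin : min (ENNReal.ofReal T) (τbar jstar) = τbar jstar :=
    min_eq_right ((ENNReal.le_ofReal_iff_toReal_le hfin.ne
      (ENNReal.toReal_nonneg.trans hT)).mpr hT)
  have hcol : (τbar jstar).toReal / n
      ≤ ∑ j, Z j k * ((min (ENNReal.ofReal T) (τbar j)).toReal * Z j k) := by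
    calc (τbar jstar).toReal / n = (τbar jstar).toReal * (1 / n) := by ring
      _ ≤ (τbar jstar).toReal * Z jstar k ^ 2 := by gcongr
      _ = Z jstar k * ((min (ENNReal.ofReal T) (τbar jstar)).toReal * Z jstar k) := by
          rw [hmin]; ring
      _ ≤ _ := Finset.single_le_sum
          (f := fun j => Z j k * ((min (ENNReal.ofReal T) (τbar j)).toReal * Z j k))
          (fun j _ => by
            have h := mul_nonneg (ENNReal.toReal_nonneg (a := min (ENNReal.ofReal T) (τbar j)))
              (sq_nonneg (Z j k))
            linarith) (Finset.mem_univ jstar)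
  rw [← div_pow]
  calc ((τbar jstar).toReal / n) ^ 2
      ≤ (∑ j, Z j k * ((min (ENNReal.ofReal T) (τbar j)).toReal * Z j k)) ^ 2 := by gcongr
    _ ≤ _ := Finset.single_le_sum
        (f := fun i => (∑ j, Z j i * ((min (ENNReal.ofReal T) (τbar j)).toReal * Z j k)) ^ 2)
        (fun i _ => sq_nonneg _) (Finset.mem_univ k)
end

section
/- Fix p ∈ [1, ∞] and let κ_p > 0 be any constant such that ‖w‖_p ≤ κ_p‖w‖₂ for all w ∈ ℝⁿ. Let Z ∈ ℝ^{n×m} have orthonormal columns, let z be one of the columns of Z, let τ̄₁, …, τ̄ₙ ∈ [0, ∞], and let j* be any index maximizing |z_j| over j ∈ {1,…,n}. For τ ≥ 0 define d(τ) ∈ ℝⁿ by d(τ)_j = min(τ, τ̄_j) z_j (with min(τ, ∞) = τ). If τ̂ ≥ 0 satisfies ‖d(τ̂)‖_p = Δ for some Δ > 0, then ‖Zᵀ d(τ̂)‖₂² ≥ (min{Δ/κ_p, τ̄_{j*}})² / n² (where min{Δ/κ_p, ∞} = Δ/κ_p). -/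
open Matrix
open scoped ENNReal

/-- Euclidean norm of a vector in `ℝᵏ`. -/
noncomputable def e2 {k : ℕ} (v : Fin k → ℝ) : ℝ := Real.sqrt (∑ i, (v i) ^ 2)

/-- ℓ^p norm (`p ∈ [1,∞]`) of a vector in `ℝᵏ`. -/
noncomputable def pnorm (p : ℝ≥0∞) [Fact (1 ≤ p)] {k : ℕ} (w : Fin k → ℝ) : ℝ :=
  ‖((WithLp.equiv p (Fin k → ℝ)).symm w : PiLp p fun _ : Fin k => ℝ)‖

/-- Scaling a Euclidean unit vector entrywise by factors in `[0, τ]` gives a vector of Euclidean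
norm at most `τ`. -/
theorem e2_mul_le {n : ℕ} {t z : Fin n → ℝ} {τ : ℝ} (hτ : 0 ≤ τ) (ht0 : ∀ j, 0 ≤ t j)
    (ht : ∀ j, t j ≤ τ) (hz : ∑ j, z j ^ 2 = 1) : e2 (fun j => t j * z j) ≤ τ := by
  refine Real.sqrt_le_iff.mpr ⟨hτ, ?_⟩
  calc ∑ j, (t j * z j) ^ 2 ≤ ∑ j, τ ^ 2 * z j ^ 2 := by
        refine Finset.sum_le_sum fun j _ => ?_
        rw [mul_pow]
        exact mul_le_mul_of_nonneg_right (pow_le_pow_left₀ (ht0 j) (ht j) 2) (sq_nonneg _)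
    _ = τ ^ 2 := by rw [← Finset.mul_sum, hz, mul_one]

/-- The largest squared entry of a Euclidean unit vector in `ℝⁿ` is at least `1 / n`. -/
theorem inv_card_le_sq_of_abs_le {n : ℕ} {z : Fin n → ℝ} (hz : ∑ j, z j ^ 2 = 1) {i : Fin n}
    (hi : ∀ j, |z j| ≤ |z i|) : (n : ℝ)⁻¹ ≤ z i ^ 2 := by
  have hn : (0 : ℝ) < n := Nat.cast_pos.mpr i.pos
  rw [inv_le_iff_one_le_mul₀' hn, ← hz]
  calc ∑ j, z j ^ 2 ≤ ∑ _j : Fin n, z i ^ 2 :=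
        Finset.sum_le_sum fun j _ => sq_le_sq.mpr (hi j)
    _ = n * z i ^ 2 := by simp

/-- If the clipped step `d(τ̂)`, with `d(τ)_j = min(τ, τ̄_j) z_j` along a
column `z` of an orthonormal-column matrix `Z`, hits the trust-region boundary
`‖d(τ̂)‖_p = Δ > 0`, then `‖Zᵀ d(τ̂)‖₂² ≥ min{Δ/κ_p, τ̄_{j*}}²/n²`, where `j*` maximizes
`|z_j|`. -/
theorem stmt_7 (n m : ℕ) (p : ℝ≥0∞) [Fact (1 ≤ p)]
    (κp : ℝ) (hκp : 0 < κp)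
    (hκ : ∀ w : Fin n → ℝ, pnorm p w ≤ κp * e2 w)
    (Z : Matrix (Fin n) (Fin m) ℝ) (hZ : Zᵀ * Z = 1)
    (k : Fin m) (τbar : Fin n → ℝ≥0∞) (jstar : Fin n)
    (hjstar : ∀ j, |Z j k| ≤ |Z jstar k|)
    (τhat : ℝ) (hτhat : 0 ≤ τhat) (Δ : ℝ) (hΔ : 0 < Δ)
    (hd : pnorm p (fun j => (min (ENNReal.ofReal τhat) (τbar j)).toReal * Z j k) = Δ) :
    (min (ENNReal.ofReal (Δ / κp)) (τbar jstar)).toReal ^ 2 / (n : ℝ) ^ 2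
      ≤ ∑ i, (∑ j, Z j i * ((min (ENNReal.ofReal τhat) (τbar j)).toReal * Z j k)) ^ 2 := by
  have hz : ∑ j, Z j k ^ 2 = 1 := by
    simpa [Matrix.mul_apply, sq] using congrFun (congrFun hZ k) k
  set t : Fin n → ℝ := fun j => (min (ENNReal.ofReal τhat) (τbar j)).toReal
  have ht0 : ∀ j, 0 ≤ t j := fun j => ENNReal.toReal_nonneg
  have ht : ∀ j, t j ≤ τhat := fun j =>
    ENNReal.toReal_le_of_le_ofReal hτhat (min_le_left _ _)
  have hΔτ : Δ / κp ≤ τhat := by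
    rw [div_le_iff₀' hκp, ← hd]
    exact (hκ _).trans (mul_le_mul_of_nonneg_left (e2_mul_le hτhat ht0 ht hz) hκp.le)
  have hmin : (min (ENNReal.ofReal (Δ / κp)) (τbar jstar)).toReal ≤ t jstar :=
    ENNReal.toReal_mono (ne_top_of_le_ne_top ENNReal.ofReal_ne_top (min_le_left _ _))
      (min_le_min_right _ (ENNReal.ofReal_le_ofReal hΔτ))
  have hcol : t jstar * (n : ℝ)⁻¹ ≤ ∑ j, Z j k * (t j * Z j k) :=
    calc t jstar * (n : ℝ)⁻¹ ≤ t jstar * Z jstar k ^ 2 :=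
          mul_le_mul_of_nonneg_left (inv_card_le_sq_of_abs_le hz hjstar) (ht0 jstar)
      _ ≤ ∑ j, t j * Z j k ^ 2 :=
          Finset.single_le_sum (f := fun j => t j * Z j k ^ 2)
            (fun j _ => mul_nonneg (ht0 j) (sq_nonneg _)) (Finset.mem_univ jstar)
      _ = ∑ j, Z j k * (t j * Z j k) := Finset.sum_congr rfl fun j _ => by ring
  calc (min (ENNReal.ofReal (Δ / κp)) (τbar jstar)).toReal ^ 2 / (n : ℝ) ^ 2
      ≤ t jstar ^ 2 / (n : ℝ) ^ 2 := by gcongr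
    _ = (t jstar * (n : ℝ)⁻¹) ^ 2 := by rw [← div_eq_mul_inv, div_pow]
    _ ≤ (∑ j, Z j k * (t j * Z j k)) ^ 2 :=
        pow_le_pow_left₀ (mul_nonneg (ht0 jstar) (by positivity)) hcol 2
    _ ≤ ∑ i, (∑ j, Z j i * (t j * Z j k)) ^ 2 :=
        Finset.single_le_sum (f := fun i => (∑ j, Z j i * (t j * Z j k)) ^ 2)
          (fun i _ => sq_nonneg _) (Finset.mem_univ k)
end

section
/- Fix n ≥ 1, p ∈ [1, ∞], Δ_max > 0, and let κ_p > 0 be any constant such that ‖w‖_p ≤ κ_p‖w‖₂ for all w ∈ ℝⁿ. Let x_L ∈ (ℝ ∪ {−∞})ⁿ and x_U ∈ (ℝ ∪ {+∞})ⁿ with x_{L,j} < x_{U,j} for all j, and let ξ > 0 satisfy ξ ≤ 1/(n κ_p) and 2 n Δ_max ξ ≤ x_{U,j} − x_{L,j} for every j (the latter being automatic when the difference is +∞). Then for every x ∈ ℝⁿ with x_L ≤ x ≤ x_U, every Δ with 0 < Δ ≤ Δ_max, and every Z ∈ ℝ^{n×m} with 1 ≤ m ≤ n having orthonormal columns, there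 exists d ∈ ℝⁿ such that ‖Zᵀd‖₂ ≥ ξ Δ, ‖d‖_p ≤ Δ, and x_L ≤ x + d ≤ x_U. -/
open Matrix
open scoped ENNReal

/-- A point of an extended-real interval of length at least `2 * t` can move by `t` to the left or
to the right without leaving the interval. -/
lemma exists_abs_eq_add_mem_of_two_mul_le {l u : EReal} {x s t : ℝ} (ht : 0 ≤ t)
    (hst : 2 * t ≤ s) (hs : (s : EReal) ≤ u - l) (hl : l ≤ x) (hu : x ≤ u) :
    ∃ c : ℝ, |c| = t ∧ l ≤ ((x + c : ℝ) : EReal) ∧ ((x + c : ℝ) : EReal) ≤ u := by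
  by_cases h1 : ((x + t : ℝ) : EReal) ≤ u
  · exact ⟨t, abs_of_nonneg ht, hl.trans (EReal.coe_le_coe_iff.2 (by linarith)), h1⟩
  by_cases h2 : l ≤ ((x + -t : ℝ) : EReal)
  · exact ⟨-t, by rw [abs_neg, abs_of_nonneg ht], h2,
      (EReal.coe_le_coe_iff.2 (by linarith)).trans hu⟩
  exfalso
  rw [not_le] at h1 h2
  lift u to ℝ using ⟨(h1.trans (EReal.coe_lt_top _)).ne, ((EReal.bot_lt_coe _).trans_le hu).ne'⟩
  lift l to ℝ using ⟨(hl.trans_lt (EReal.coe_lt_top _)).ne, ((EReal.bot_lt_coe _).trans h2).ne'⟩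
  norm_cast at hs h1 h2
  linarith

/-- A matrix with `n` rows and at least one column, all of them orthonormal, has a row whose
squared Euclidean norm is at least `1 / n`. -/
lemma exists_one_le_card_mul_row_sq {n m : ℕ} (hm : 1 ≤ m) (Z : Matrix (Fin n) (Fin m) ℝ)
    (hZ : Zᵀ * Z = 1) : ∃ j, 1 ≤ n * ∑ i, Z j i ^ 2 := by
  by_contra! h
  have hcol (i : Fin m) : ∑ j, Z j i ^ 2 = 1 := by
    have := congrFun (congrFun hZ i) i
    simpa [Matrix.mul_apply, pow_two] using this
  have hsum : ∑ j, ∑ i, Z j i ^ 2 = m := by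
    rw [Finset.sum_comm]
    simp [hcol]
  have hm' : (1 : ℝ) ≤ m := by exact_mod_cast hm
  have hne : (Finset.univ : Finset (Fin n)).Nonempty := by
    by_contra hne
    rw [Finset.not_nonempty_iff_eq_empty] at hne
    rw [hne, Finset.sum_empty] at hsum
    linarith
  have hlt := Finset.sum_lt_sum_of_nonempty hne fun j _ => h j
  rw [← Finset.mul_sum, hsum] at hlt
  simp only [Finset.sum_const, Finset.card_univ, Fintype.card_fin, nsmul_eq_mul, mul_one] at hlt
  nlinarith [Nat.cast_nonneg (α := ℝ) n]

lemma e2_single {n : ℕ} (j : Fin n) (c : ℝ) : e2 (Pi.single j c) = |c| := by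
  rw [e2, Finset.sum_eq_single j (fun b _ hb => by simp [hb]) (by simp), Pi.single_eq_same,
    Real.sqrt_sq_eq_abs]

lemma e2_mul_right {k : ℕ} (v : Fin k → ℝ) (c : ℝ) : e2 (fun i => v i * c) = |c| * e2 v := by
  simp only [e2, mul_pow, ← Finset.sum_mul]
  rw [mul_comm, Real.sqrt_mul (sq_nonneg c), Real.sqrt_sq_eq_abs]

/-- If the well-poisedness parameter `ξ` satisfies `ξ ≤ 1/(nκ_p)` and
`2nΔ_max ξ ≤ x_{U,j} − x_{L,j}` for all `j`, then for every feasible `x` in the box, every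
`0 < Δ ≤ Δ_max`, and every `Z ∈ ℝ^{n×m}` (`1 ≤ m ≤ n`) with orthonormal columns, there is a
feasible direction `d` in the trust region with `‖Zᵀd‖₂ ≥ ξΔ`. -/
theorem stmt_8 (n : ℕ) (hn : 1 ≤ n) (p : ℝ≥0∞) [Fact (1 ≤ p)]
    (Δmax : ℝ) (hΔmax : 0 < Δmax)
    (κp : ℝ) (hκp : 0 < κp)
    (hκ : ∀ w : Fin n → ℝ, pnorm p w ≤ κp * e2 w)
    (xL xU : Fin n → EReal) (hbox : ∀ j, xL j < xU j)
    (ξ : ℝ) (hξ : 0 < ξ) (hξ1 : ξ ≤ 1 / (n * κp))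
    (hξ2 : ∀ j, ((2 * n * Δmax * ξ : ℝ) : EReal) ≤ xU j - xL j) :
    ∀ x : Fin n → ℝ, (∀ j, xL j ≤ (x j : EReal) ∧ (x j : EReal) ≤ xU j) →
    ∀ Δ : ℝ, 0 < Δ → Δ ≤ Δmax →
    ∀ m : ℕ, 1 ≤ m → m ≤ n →
    ∀ Z : Matrix (Fin n) (Fin m) ℝ, Zᵀ * Z = 1 →
    ∃ d : Fin n → ℝ,
      ξ * Δ ≤ e2 (fun i => ∑ j, Z j i * d j) ∧
      pnorm p d ≤ Δ ∧
      ∀ j, xL j ≤ ((x j + d j : ℝ) : EReal) ∧ ((x j + d j : ℝ) : EReal) ≤ xU j := by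
  intro x hx Δ hΔ hΔle m hm _ Z hZ
  have hn' : (1 : ℝ) ≤ n := by exact_mod_cast hn
  obtain ⟨j, hj⟩ := exists_one_le_card_mul_row_sq hm Z hZ
  obtain ⟨c, hc, hcl, hcu⟩ := exists_abs_eq_add_mem_of_two_mul_le (t := n * Δ * ξ)
    (by positivity) (by rw [← mul_assoc, ← mul_assoc]; gcongr) (hξ2 j) (hx j).1 (hx j).2
  refine ⟨Pi.single j c, ?_, ?_, fun k => ?_⟩
  · have hrow : 1 ≤ n * e2 (Z j) := by
      have h0 : 0 ≤ e2 (Z j) := Real.sqrt_nonneg _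
      have hsq : e2 (Z j) ^ 2 = ∑ i, Z j i ^ 2 :=
        Real.sq_sqrt (Finset.sum_nonneg fun i _ => sq_nonneg _)
      rw [← hsq] at hj
      refine (one_le_sq_iff₀ (by positivity)).1 (hj.trans ?_)
      rw [mul_pow]
      gcongr
      nlinarith
    have hd : (fun i => ∑ k, Z k i * (Pi.single j c : Fin n → ℝ) k) = fun i => Z j i * c := by
      ext i
      rw [Finset.sum_eq_single j (fun b _ hb => by simp [hb]) (by simp), Pi.single_eq_same]
    rw [hd, e2_mul_right, hc]
    calc ξ * Δ = ξ * Δ * 1 := (mul_one _).symm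
      _ ≤ ξ * Δ * (n * e2 (Z j)) := by gcongr
      _ = n * Δ * ξ * e2 (Z j) := by ring
  · rw [le_div_iff₀ (by positivity)] at hξ1
    calc pnorm p (Pi.single j c) ≤ κp * e2 (Pi.single j c) := hκ _
      _ = ξ * (n * κp) * Δ := by rw [e2_single, hc]; ring
      _ ≤ 1 * Δ := by gcongr
      _ = Δ := one_mul _
  · obtain rfl | hk := eq_or_ne k j
    · rw [Pi.single_eq_same]
      exact ⟨hcl, hcu⟩
    · rw [Pi.single_eq_of_ne hk, add_zero]
      exact hx k
end

section
/- Let n ≥ 1, Δ > 0, ξ > 0, κ > 0, and let d₁, …, dₙ ∈ ℝⁿ with ‖d_i‖₂ ≤ κΔ for all i. Let D = [d₁ ⋯ dₙ] ∈ ℝ^{n×n} and suppose there exist Q ∈ ℝ^{n×n} with orthonormal columns and R ∈ ℝ^{n×n} upper triangular such that D/Δ = QR and |R_{ii}| ≥ ξ for all i ∈ {1,…,n}. Then D is invertible and ‖D^{−1}‖₂ ≤ n^{(n−1)/2} κ^{n−1} / (ξⁿ Δ). -/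
open Matrix

lemma e2_sq {k : ℕ} (v : Fin k → ℝ) : e2 v ^ 2 = ∑ i, v i ^ 2 :=
  Real.sq_sqrt (Finset.sum_nonneg fun _ _ => sq_nonneg _)

lemma e2_nonneg {k : ℕ} (v : Fin k → ℝ) : 0 ≤ e2 v := Real.sqrt_nonneg _

lemma e2_sq_eq_dotProduct {k : ℕ} (v : Fin k → ℝ) : e2 v ^ 2 = v ⬝ᵥ v := by
  rw [e2_sq]
  simp [dotProduct, sq]

/-- If every eigenvalue of a real symmetric matrix is at least `c / T`, so is its
Rayleigh quotient (stated without division). -/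
lemma Matrix.IsHermitian.mul_dotProduct_le {ι : Type*} [Fintype ι] [DecidableEq ι]
    {M : Matrix ι ι ℝ} (hM : M.IsHermitian) {c T : ℝ}
    (h : ∀ i, c ≤ T * hM.eigenvalues i) (v : ι → ℝ) :
    c * (v ⬝ᵥ v) ≤ T * (v ⬝ᵥ M *ᵥ v) := by
  set U : Matrix ι ι ℝ := (hM.eigenvectorUnitary : Matrix ι ι ℝ)
  have hUU : U * Uᵀ = 1 := by
    have := Unitary.coe_mul_star_self hM.eigenvectorUnitary
    simpa [star_eq_conjTranspose] using this
  have hspec : M = U * diagonal hM.eigenvalues * Uᵀ := by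
    have := hM.spectral_theorem
    rw [Unitary.conjStarAlgAut_apply] at this
    simpa [star_eq_conjTranspose, Function.comp_def] using this
  set w := Uᵀ *ᵥ v with hw
  have h1 : v ⬝ᵥ v = ∑ i, w i ^ 2 := by
    calc v ⬝ᵥ v = v ⬝ᵥ (U * Uᵀ) *ᵥ v := by rw [hUU, one_mulVec]
      _ = w ⬝ᵥ w := by
        rw [← mulVec_mulVec, dotProduct_mulVec, ← mulVec_transpose]
      _ = _ := by simp [dotProduct, sq]
  have h2 : v ⬝ᵥ M *ᵥ v = ∑ i, hM.eigenvalues i * w i ^ 2 := by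
    calc v ⬝ᵥ M *ᵥ v = v ⬝ᵥ (U * diagonal hM.eigenvalues * Uᵀ) *ᵥ v := by rw [← hspec]
      _ = w ⬝ᵥ diagonal hM.eigenvalues *ᵥ w := by
        rw [← mulVec_mulVec, ← mulVec_mulVec, dotProduct_mulVec, ← mulVec_transpose]
      _ = _ := by
        simp only [dotProduct, mulVec_diagonal]
        exact Finset.sum_congr rfl fun i _ => by ring
  rw [h1, h2, Finset.mul_sum, Finset.mul_sum]
  refine Finset.sum_le_sum fun i _ => ?_
  rw [← mul_assoc]
  exact mul_le_mul_of_nonneg_right (h i) (sq_nonneg _)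

/-- A lower bound for the smallest singular value of a square matrix in terms of its determinant
and a bound `T` on its squared Frobenius norm. -/
lemma det_sq_mul_dotProduct_le {ι : Type*} [Fintype ι] [DecidableEq ι]
    (A : Matrix ι ι ℝ) {T : ℝ} (hT : (Aᵀ * A).trace ≤ T) (v : ι → ℝ) :
    A.det ^ 2 * (v ⬝ᵥ v) ≤ T ^ (Fintype.card ι - 1) * (A *ᵥ v ⬝ᵥ A *ᵥ v) := by
  have hpos : (Aᵀ * A).PosSemidef := by
    simpa using posSemidef_conjTranspose_mul_self A
  have hM := hpos.isHermitian
  have hev : ∀ i, 0 ≤ hM.eigenvalues i := hpos.eigenvalues_nonneg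
  have hle : ∀ i, hM.eigenvalues i ≤ T := fun i => by
    refine le_trans ?_ hT
    rw [hM.trace_eq_sum_eigenvalues]
    exact Finset.single_le_sum (f := hM.eigenvalues) (fun j _ => hev j) (Finset.mem_univ i)
  have hdet : A.det ^ 2 = ∏ i, hM.eigenvalues i := by
    have := hM.det_eq_prod_eigenvalues
    rw [det_mul, det_transpose, ← sq] at this
    simpa using this
  have key := hM.mul_dotProduct_le (c := A.det ^ 2) (T := T ^ (Fintype.card ι - 1))
    (fun i => ?_) v
  · rwa [← mulVec_mulVec, dotProduct_mulVec, vecMul_transpose] at key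
  · rw [hdet, ← Finset.prod_erase_mul _ _ (Finset.mem_univ i)]
    refine mul_le_mul_of_nonneg_right ?_ (hev i)
    calc ∏ j ∈ Finset.univ.erase i, hM.eigenvalues j
        ≤ ∏ _j ∈ Finset.univ.erase i, T :=
          Finset.prod_le_prod (fun j _ => hev j) fun j _ => hle j
      _ = T ^ (Fintype.card ι - 1) := by
        rw [Finset.prod_const, Finset.card_erase_of_mem (Finset.mem_univ i), Finset.card_univ]

/-- The determinant of a product of an orthogonal matrix and an upper triangular matrix whose
pivots have magnitude at least `ξ`. -/
lemma pow_le_abs_det_mul {n : ℕ} {ξ : ℝ} (hξ : 0 ≤ ξ) {Q R : Matrix (Fin n) (Fin n) ℝ}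
    (hQ : Qᵀ * Q = 1) (hR : ∀ i j : Fin n, j < i → R i j = 0) (hpiv : ∀ i, ξ ≤ |R i i|) :
    ξ ^ n ≤ |(Q * R).det| := by
  have hQdet : |Q.det| = 1 := by
    have := congrArg det hQ
    rw [det_mul, det_transpose, det_one, ← sq] at this
    rwa [← sq_abs, pow_eq_one_iff_of_nonneg (abs_nonneg _) two_ne_zero] at this
  have hRdet : R.det = ∏ i, R i i := det_of_isUpperTriangular fun i j hij => hR i j hij
  rw [det_mul, abs_mul, hQdet, one_mul, hRdet, Finset.abs_prod]
  simpa using Finset.prod_le_prod (s := Finset.univ) (fun _ _ => hξ) fun i _ => hpiv i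

/-- If the scaled direction matrix `D/Δ` (columns `d_i/Δ`, with
`‖d_i‖₂ ≤ κΔ`) has a QR factorization whose pivots all satisfy `|R_{ii}| ≥ ξ`, then `D` is
invertible and `‖D⁻¹‖₂ ≤ n^{(n−1)/2} κ^{n−1}/(ξⁿΔ)` (the spectral-norm bound being expressed
as `∀ v, ‖D⁻¹v‖₂ ≤ (n^{(n−1)/2}κ^{n−1}/(ξⁿΔ))‖v‖₂`). -/
theorem stmt_10 (n : ℕ) (hn : 1 ≤ n) (Δ ξ κ : ℝ) (hΔ : 0 < Δ) (hξ : 0 < ξ) (hκ : 0 < κ)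
    (d : Fin n → Fin n → ℝ) (hd : ∀ i, e2 (d i) ≤ κ * Δ)
    (Q R : Matrix (Fin n) (Fin n) ℝ) (hQ : Qᵀ * Q = 1)
    (hR : ∀ i j : Fin n, j < i → R i j = 0)
    (hQR : Δ⁻¹ • (Matrix.of fun i j => d j i) = Q * R)
    (hpiv : ∀ i, ξ ≤ |R i i|) :
    IsUnit (Matrix.of fun i j => d j i : Matrix (Fin n) (Fin n) ℝ) ∧
    ∀ v : Fin n → ℝ,
      e2 ((Matrix.of fun i j => d j i : Matrix (Fin n) (Fin n) ℝ)⁻¹.mulVec v)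
        ≤ Real.sqrt ((n : ℝ) ^ (n - 1)) * κ ^ (n - 1) / (ξ ^ n * Δ) * e2 v := by
  set D : Matrix (Fin n) (Fin n) ℝ := Matrix.of fun i j => d j i with hD
  have hdet : (Δ * ξ) ^ n ≤ |D.det| := by
    have hDQR : D = Δ • (Q * R) := by rw [← hQR, smul_inv_smul₀ hΔ.ne']
    rw [hDQR, det_smul, Fintype.card_fin, abs_mul, abs_of_pos (pow_pos hΔ n), mul_pow]
    exact mul_le_mul_of_nonneg_left (pow_le_abs_det_mul hξ.le hQ hR hpiv) (by positivity)
  have hunit : IsUnit D.det :=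
    isUnit_iff_ne_zero.2 (abs_pos.1 ((by positivity : 0 < (Δ * ξ) ^ n).trans_le hdet))
  refine ⟨(isUnit_iff_isUnit_det D).2 hunit, fun v => ?_⟩
  have htrace : (Dᵀ * D).trace ≤ n * (κ * Δ) ^ 2 := by
    calc (Dᵀ * D).trace = ∑ i, e2 (d i) ^ 2 := by
          simp_rw [e2_sq]
          simp [trace, mul_apply, hD, sq]
      _ ≤ ∑ _i : Fin n, (κ * Δ) ^ 2 :=
          Finset.sum_le_sum fun i _ => pow_le_pow_left₀ (e2_nonneg _) (hd i) 2
      _ = n * (κ * Δ) ^ 2 := by simp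
  have key := det_sq_mul_dotProduct_le D htrace (D⁻¹ *ᵥ v)
  rw [mulVec_mulVec, mul_nonsing_inv D hunit, one_mulVec, Fintype.card_fin,
    ← e2_sq_eq_dotProduct, ← e2_sq_eq_dotProduct] at key
  have hsq : ((Δ * ξ) ^ n) ^ 2 ≤ D.det ^ 2 := by
    rw [← sq_abs D.det]
    exact pow_le_pow_left₀ (by positivity) hdet 2
  have hbound := (mul_le_mul_of_nonneg_right hsq (sq_nonneg (e2 (D⁻¹ *ᵥ v)))).trans key
  have hsqrt := Real.sq_sqrt (by positivity : 0 ≤ (n : ℝ) ^ (n - 1))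
  obtain ⟨m, rfl⟩ : ∃ m, n = m + 1 := ⟨n - 1, by omega⟩
  have hroot : (Δ * ξ) ^ (m + 1) * e2 (D⁻¹ *ᵥ v)
      ≤ √(((m + 1 : ℕ) : ℝ) ^ m) * (κ * Δ) ^ m * e2 v := by
    refine (sq_le_sq₀ (mul_nonneg (by positivity) (e2_nonneg _)) ?_).1 ?_
    · exact mul_nonneg (by positivity) (e2_nonneg _)
    · simp only [add_tsub_cancel_right] at hbound hsqrt
      rw [mul_pow, mul_pow _ (e2 v), mul_pow _ ((κ * Δ) ^ m), hsqrt]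
      refine hbound.trans_eq ?_
      rw [mul_pow, pow_right_comm (κ * Δ)]
  simp only [add_tsub_cancel_right]
  rw [div_mul_eq_mul_div, le_div_iff₀ (by positivity)]
  refine le_of_mul_le_mul_left ?_ (pow_pos hΔ m)
  calc Δ ^ m * (e2 (D⁻¹ *ᵥ v) * (ξ ^ (m + 1) * Δ))
      = (Δ * ξ) ^ (m + 1) * e2 (D⁻¹ *ᵥ v) := by ring
    _ ≤ √(((m + 1 : ℕ) : ℝ) ^ m) * (κ * Δ) ^ m * e2 v := hroot
    _ = _ := by rw [mul_pow]; ring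
end

section
/- Let ε_c > 0, μ > 0, κ_eg ≥ 0, ε > 0, Δ > 0, and let π_m ≥ 0 and π_f be real numbers. (i) If it is not the case that both π_m ≤ ε_c and Δ > μπ_m hold, then π_m ≥ min{ε_c, Δ/μ}. (ii) If in addition π_f ≥ ε and π_f ≤ π_m + κ_eg Δ, then π_m ≥ min{ε_c, ε/(1 + κ_eg μ)}. -/
/-- If the criticality test (`π_m ≤ ε_c` and `Δ > μπ_m`) fails, then
`π_m ≥ min{ε_c, Δ/μ}`; if moreover `π_f ≥ ε` and `π_f ≤ π_m + κ_eg Δ` (the fully-linear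
bound), then `π_m ≥ min{ε_c, ε/(1 + κ_eg μ)}`. -/
theorem stmt_16 (εc μ κeg ε Δ πm πf : ℝ)
    (hεc : 0 < εc) (hμ : 0 < μ) (hκeg : 0 ≤ κeg) (hε : 0 < ε) (hΔ : 0 < Δ)
    (hπm : 0 ≤ πm)
    (hcrit : ¬(πm ≤ εc ∧ μ * πm < Δ)) :
    min εc (Δ / μ) ≤ πm ∧
    (ε ≤ πf → πf ≤ πm + κeg * Δ → min εc (ε / (1 + κeg * μ)) ≤ πm) := by
  by_cases h : πm ≤ εc
  · have hle : Δ ≤ μ * πm := not_lt.mp fun hlt => hcrit ⟨h, hlt⟩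
    refine ⟨min_le_of_right_le ?_, fun hf hfm => min_le_of_right_le ?_⟩
    · rw [div_le_iff₀ hμ]
      linarith
    · have hpos : 0 < 1 + κeg * μ := by positivity
      rw [div_le_iff₀ hpos]
      have hmul := mul_le_mul_of_nonneg_left hle hκeg
      linarith
  · have hlt : εc ≤ πm := (not_le.mp h).le
    exact ⟨min_le_of_left_le hlt, fun _ _ => min_le_of_left_le hlt⟩
end

section
/- Let n ≥ 1, and let f, m : ℝⁿ → ℝ, x, s ∈ ℝⁿ, and constants η ∈ (0,1), μ > 0, κ_fcd ∈ (0,1], κ_ef > 0, κ_bhm > 0, π > 0, Δ > 0. Define c₀ := min{μ, 1/(κ_bhm + 1), κ_fcd(1 − η)/(2κ_ef)}. Suppose: (a) Δ ≤ min{c₀ π, 1}; (b) m(x) − m(x + s) ≥ κ_fcd · π · min{π/(κ_bhm + 1), Δ, 1}; (c) |f(x) − m(x)| ≤ κ_ef Δ² and |f(x + s) − m(x + s)| ≤ κ_ef Δ². Then Δ ≤ μπ, m(x) − m(x + s) ≥ κ_fcd π Δ > 0, and the ratio ρ := (f(x) − f(x + s)) / (m(x) − m(x + s)) satisfies ρ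 ≥ η. -/
/-- If the trust-region radius satisfies `Δ ≤ min{c₀π, 1}` with
`c₀ = min{μ, 1/(κ_bhm+1), κ_fcd(1−η)/(2κ_ef)}`, the step `s` achieves Cauchy decrease, and
the model `m` is fully linear with respect to `f` at `x` and `x + s`, then the criticality
test is not triggered (`Δ ≤ μπ`), the predicted decrease satisfies
`m(x) − m(x+s) ≥ κ_fcd π Δ > 0`, and the actual-to-predicted ratio `ρ` is at least `η`. -/
theorem stmt_17 (n : ℕ) (hn : 1 ≤ n)
    (f m : (Fin n → ℝ) → ℝ) (x s : Fin n → ℝ)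
    (η μ κfcd κef κbhm π Δ : ℝ)
    (hη : 0 < η) (hη1 : η < 1) (hμ : 0 < μ) (hκfcd : 0 < κfcd) (hκfcd1 : κfcd ≤ 1)
    (hκef : 0 < κef) (hκbhm : 0 < κbhm) (hπ : 0 < π) (hΔ : 0 < Δ)
    (hΔsmall : Δ ≤ min (min μ (min (1 / (κbhm + 1)) (κfcd * (1 - η) / (2 * κef))) * π) 1)
    (hcauchy : κfcd * π * min (π / (κbhm + 1)) (min Δ 1) ≤ m x - m (x + s))
    (hfl1 : |f x - m x| ≤ κef * Δ ^ 2)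
    (hfl2 : |f (x + s) - m (x + s)| ≤ κef * Δ ^ 2) :
    Δ ≤ μ * π ∧
    κfcd * π * Δ ≤ m x - m (x + s) ∧
    0 < m x - m (x + s) ∧
    η ≤ (f x - f (x + s)) / (m x - m (x + s)) := by
  obtain ⟨hΔc, hΔ1⟩ := le_min_iff.mp hΔsmall
  have hΔμ : Δ ≤ μ * π :=
    hΔc.trans (mul_le_mul_of_nonneg_right (min_le_left _ _) hπ.le)
  have hΔbhm : Δ ≤ π / (κbhm + 1) := by
    have h : Δ ≤ 1 / (κbhm + 1) * π :=
      hΔc.trans (mul_le_mul_of_nonneg_right ((min_le_right _ _).trans (min_le_left _ _)) hπ.le)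
    rwa [one_div_mul_eq_div] at h
  have hΔef : 2 * κef * Δ ≤ κfcd * (1 - η) * π := by
    have h : Δ ≤ κfcd * (1 - η) / (2 * κef) * π :=
      hΔc.trans (mul_le_mul_of_nonneg_right ((min_le_right _ _).trans (min_le_right _ _)) hπ.le)
    rw [div_mul_eq_mul_div, le_div_iff₀ (by positivity)] at h
    linarith
  have hdecrease : κfcd * π * Δ ≤ m x - m (x + s) := by
    rwa [min_eq_left hΔ1, min_eq_right hΔbhm] at hcauchy
  have hpos : 0 < m x - m (x + s) := lt_of_lt_of_le (by positivity) hdecrease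
  refine ⟨hΔμ, hdecrease, hpos, ?_⟩
  rw [le_div_iff₀ hpos]
  have herror : 2 * κef * Δ ^ 2 ≤ (1 - η) * (m x - m (x + s)) :=
    calc 2 * κef * Δ ^ 2 = 2 * κef * Δ * Δ := by ring
      _ ≤ κfcd * (1 - η) * π * Δ := mul_le_mul_of_nonneg_right hΔef hΔ.le
      _ = (1 - η) * (κfcd * π * Δ) := by ring
      _ ≤ (1 - η) * (m x - m (x + s)) :=
        mul_le_mul_of_nonneg_left hdecrease (sub_nonneg.mpr hη1.le)
  linarith [(abs_le.mp hfl1).1, (abs_le.mp hfl2).2]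
end
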